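/- Under the stated hypotheses on ψ₁ and Γ (including Γ(r,±a) = 0), there is an absolute constant c such that ∫_Ω ( (∂_r²∂_zψ₁)² + (∂_r∂_z²ψ₁)² + (∂_z³ψ₁)² ) + ∫_{−a}^{a} (∂_z²ψ₁(0,z))² dz + ∫_{−a}^{a} (∂_r∂_zψ₁(R,z))² dz ≤ c |∂_zΓ|²_{2,Ω}. -/

import Mathlib

open MeasureTheory Real Set ENNReal

noncomputable section

/-- Partial derivative in `r` of a function `w r z` of two variables. -/
def qdr (w : ℝ → ℝ → ℝ) : ℝ → ℝ → ℝ := fun r z => deriv (fun x => w x z) r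

/-- Partial derivative in `z` of a function `w r z` of two variables. -/
def qdz (w : ℝ → ℝ → ℝ) : ℝ → ℝ → ℝ := fun r z => deriv (fun x => w r x) z

/-- The integral `∫_Ω w` over the rectangle `(0,R) × (-a,a)` with respect to the
measure `r dr dz`. -/
def I2 (R a : ℝ) (w : ℝ → ℝ → ℝ) : ℝ :=
  ∫ q in (Ioo (0 : ℝ) R) ×ˢ (Ioo (-a) a), w q.1 q.2 * q.1

/-- The data of the elliptic problem for the modified stream function: smooth functions
`ψ₁` and `Γ` on the rectangle `[0,R] × [-a,a]` satisfying
`−∂_r²ψ₁ − (3/r)∂_rψ₁ − ∂_z²ψ₁ = Γ` in the interior (i.e. `−Δψ₁ − (2/r)∂_rψ₁ = Γ`),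
the boundary conditions `ψ₁(R,·) = 0`, `ψ₁(·,±a) = 0`, and the axis condition
`∂_rψ₁(0,·) = 0`. -/
structure StreamData (R a : ℝ) where
  psi : ℝ → ℝ → ℝ
  Gam : ℝ → ℝ → ℝ
  smooth_psi : ContDiff ℝ (⊤ : ℕ∞) (fun q : ℝ × ℝ => psi q.1 q.2)
  smooth_Gam : ContDiff ℝ (⊤ : ℕ∞) (fun q : ℝ × ℝ => Gam q.1 q.2)
  eqn : ∀ r ∈ Ioo (0 : ℝ) R, ∀ z ∈ Ioo (-a) a,
    -qdr (qdr psi) r z - (3 / r) * qdr psi r z - qdz (qdz psi) r z = Gam r z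
  bc_lat : ∀ z ∈ Icc (-a) a, psi R z = 0
  bc_horiz : ∀ r ∈ Icc (0 : ℝ) R, psi r a = 0 ∧ psi r (-a) = 0
  axis : ∀ z ∈ Icc (-a) a, qdr psi 0 z = 0

def Sm (w : ℝ → ℝ → ℝ) : Prop := ContDiff ℝ (⊤ : ℕ∞) (fun q : ℝ × ℝ => w q.1 q.2)

lemma Sm.hr {w : ℝ → ℝ → ℝ} (h : Sm w) (r z : ℝ) :
    HasDerivAt (fun x => w x z) (fderiv ℝ (fun q : ℝ × ℝ => w q.1 q.2) (r, z) (1, 0)) r := by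
  have h1 : HasFDerivAt (fun q : ℝ × ℝ => w q.1 q.2) _ (r, z) :=
    (ContDiff.differentiable h (by simp) (r, z)).hasFDerivAt
  have h2 : HasDerivAt (fun x : ℝ => (x, z)) ((1 : ℝ), (0 : ℝ)) r :=
    (hasDerivAt_id r).prodMk (hasDerivAt_const r z)
  exact h1.comp_hasDerivAt r h2

lemma Sm.hz {w : ℝ → ℝ → ℝ} (h : Sm w) (r z : ℝ) :
    HasDerivAt (fun x => w r x) (fderiv ℝ (fun q : ℝ × ℝ => w q.1 q.2) (r, z) (0, 1)) z := by
  have h1 : HasFDerivAt (fun q : ℝ × ℝ => w q.1 q.2) _ (r, z) :=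
    (ContDiff.differentiable h (by simp) (r, z)).hasFDerivAt
  have h2 : HasDerivAt (fun x : ℝ => (r, x)) ((0 : ℝ), (1 : ℝ)) z :=
    (hasDerivAt_const z r).prodMk (hasDerivAt_id z)
  exact h1.comp_hasDerivAt z h2

lemma Sm.qdr_eq {w : ℝ → ℝ → ℝ} (h : Sm w) (r z : ℝ) :
    qdr w r z = fderiv ℝ (fun q : ℝ × ℝ => w q.1 q.2) (r, z) (1, 0) := (h.hr r z).deriv

lemma Sm.qdz_eq {w : ℝ → ℝ → ℝ} (h : Sm w) (r z : ℝ) :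
    qdz w r z = fderiv ℝ (fun q : ℝ × ℝ => w q.1 q.2) (r, z) (0, 1) := (h.hz r z).deriv

lemma Sm.dr {w : ℝ → ℝ → ℝ} (h : Sm w) (r z : ℝ) :
    HasDerivAt (fun x => w x z) (qdr w r z) r := by
  rw [h.qdr_eq]; exact h.hr r z

lemma Sm.dz {w : ℝ → ℝ → ℝ} (h : Sm w) (r z : ℝ) :
    HasDerivAt (fun x => w r x) (qdz w r z) z := by
  rw [h.qdz_eq]; exact h.hz r z

lemma Sm.fd {w : ℝ → ℝ → ℝ} (h : Sm w) :
    ContDiff ℝ (⊤ : ℕ∞) (fderiv ℝ (fun q : ℝ × ℝ => w q.1 q.2)) :=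
  ContDiff.fderiv_right h (by simp)

lemma Sm.qdr {w : ℝ → ℝ → ℝ} (h : Sm w) : Sm (qdr w) := by
  unfold Sm
  have : (fun q : ℝ × ℝ => _root_.qdr w q.1 q.2) =
      fun q => fderiv ℝ (fun q : ℝ × ℝ => w q.1 q.2) q (1, 0) := by
    funext q; exact h.qdr_eq q.1 q.2
  rw [this]
  exact h.fd.clm_apply contDiff_const

lemma Sm.qdz {w : ℝ → ℝ → ℝ} (h : Sm w) : Sm (qdz w) := by
  unfold Sm
  have : (fun q : ℝ × ℝ => _root_.qdz w q.1 q.2) =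
      fun q => fderiv ℝ (fun q : ℝ × ℝ => w q.1 q.2) q (0, 1) := by
    funext q; exact h.qdz_eq q.1 q.2
  rw [this]
  exact h.fd.clm_apply contDiff_const

lemma Sm.cont {w : ℝ → ℝ → ℝ} (h : Sm w) : Continuous (fun q : ℝ × ℝ => w q.1 q.2) :=
  ContDiff.continuous h

lemma Sm.comm {w : ℝ → ℝ → ℝ} (h : Sm w) : _root_.qdz (_root_.qdr w) = _root_.qdr (_root_.qdz w) := by
  funext r z
  rw [h.qdr.qdz_eq, h.qdz.qdr_eq]
  have e1 : (fun q : ℝ × ℝ => _root_.qdr w q.1 q.2) =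
      fun q => fderiv ℝ (fun q : ℝ × ℝ => w q.1 q.2) q (1, 0) := by
    funext q; exact h.qdr_eq q.1 q.2
  have e2 : (fun q : ℝ × ℝ => _root_.qdz w q.1 q.2) =
      fun q => fderiv ℝ (fun q : ℝ × ℝ => w q.1 q.2) q (0, 1) := by
    funext q; exact h.qdz_eq q.1 q.2
  have hd : DifferentiableAt ℝ (fderiv ℝ (fun q : ℝ × ℝ => w q.1 q.2)) (r, z) :=
    h.fd.differentiable (by simp) _
  rw [e1, e2, fderiv_clm_apply hd (by fun_prop), fderiv_clm_apply hd (by fun_prop)]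
  simp
  exact second_derivative_symmetric
    (f := fun q : ℝ × ℝ => w q.1 q.2) (f' := fderiv ℝ (fun q : ℝ × ℝ => w q.1 q.2))
    (fun y => (ContDiff.differentiable h (by simp) y).hasFDerivAt) hd.hasFDerivAt _ _

lemma set_ae (R a : ℝ) :
    (Ioo (0 : ℝ) R) ×ˢ (Ioo (-a) a) =ᵐ[volume] Icc ((0 : ℝ), -a) (R, a) := by
  rw [← Icc_prod_Icc, Measure.volume_eq_prod]
  exact Measure.set_prod_ae_eq Ioo_ae_eq_Icc Ioo_ae_eq_Icc

lemma integ (R a : ℝ) {f : ℝ × ℝ → ℝ} (hf : Continuous f) :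
    IntegrableOn f ((Ioo (0 : ℝ) R) ×ˢ (Ioo (-a) a)) := by
  refine (hf.continuousOn.integrableOn_compact (K := Icc ((0 : ℝ), -a) (R, a)) isCompact_Icc).mono_set ?_
  rw [← Icc_prod_Icc]
  exact prod_mono Ioo_subset_Icc_self Ioo_subset_Icc_self

lemma diverg {R a : ℝ} (hR : 0 < R) (ha : 0 < a) {T P : ℝ → ℝ → ℝ} (hT : Sm T) (hP : Sm P) :
    ∫ q in (Ioo (0 : ℝ) R) ×ˢ (Ioo (-a) a), (qdr T q.1 q.2 + qdz P q.1 q.2) =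
      (((∫ x in Ioo 0 R, P x a) - ∫ x in Ioo 0 R, P x (-a)) +
        ∫ z in Ioo (-a) a, T R z) - ∫ z in Ioo (-a) a, T 0 z := by
  rw [setIntegral_congr_set (set_ae R a)]
  have key := integral_divergence_prod_Icc_of_hasFDerivAt_of_le
    (fun q : ℝ × ℝ => T q.1 q.2) (fun q : ℝ × ℝ => P q.1 q.2)
    (fderiv ℝ (fun q : ℝ × ℝ => T q.1 q.2)) (fderiv ℝ (fun q : ℝ × ℝ => P q.1 q.2))
    ((0 : ℝ), -a) (R, a) ⟨hR.le, by simp; linarith⟩ hT.cont.continuousOn hP.cont.continuousOn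
    (fun x _ => (ContDiff.differentiable hT (by simp) x).hasFDerivAt)
    (fun x _ => (ContDiff.differentiable hP (by simp) x).hasFDerivAt)
    (by
      refine Continuous.integrableOn_Icc ?_
      exact (hT.fd.continuous.clm_apply continuous_const).add
        (hP.fd.continuous.clm_apply continuous_const))
  simp only [intervalIntegral.integral_of_le hR.le,
    intervalIntegral.integral_of_le (show -a ≤ a by linarith), integral_Ioc_eq_integral_Ioo] at key
  rw [← key]
  congr 1
  funext q
  rw [hT.qdr_eq, hP.qdz_eq]

lemma deriv_zero_on {f : ℝ → ℝ} {l u x : ℝ} (hx : x ∈ Ioo l u) (h : ∀ y ∈ Ioo l u, f y = 0) :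
    deriv f x = 0 := by
  have : f =ᶠ[nhds x] fun _ => 0 := by
    filter_upwards [isOpen_Ioo.mem_nhds hx] with y hy using h y hy
  rw [this.deriv_eq]; simp

lemma ptwise {r A B C D g : ℝ} (hr : 0 < r) (E : r * A + 3 * B + r * C + r * g = 0) :
    r * A ^ 2 + 6 * A * B + r * D ^ 2 + r * C ^ 2 + 4 * (r * A * C + 3 * B * C - r * D ^ 2)
      ≤ 2 * g ^ 2 * r := by
  have h1 : r * A ^ 2 + 6 * A * B ≤ r * (C + g) ^ 2 := by
    refine le_of_mul_le_mul_left ?_ hr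
    have : r * (C + g) = -(r * A + 3 * B) := by linarith
    have h2 : r * (r * (C + g) ^ 2) = (r * A + 3 * B) ^ 2 := by
      calc r * (r * (C + g) ^ 2) = (r * (C + g)) ^ 2 := by ring
        _ = _ := by rw [this]; ring
    rw [h2]; nlinarith [sq_nonneg B]
  have h3 : r * A * C + 3 * B * C = - (r * C ^ 2 + r * g * C) := by
    linear_combination C * E
  have h4 : 0 ≤ r * D ^ 2 := by positivity
  have h5 : 0 ≤ r * (C + g) ^ 2 := by positivity
  have h6 : 0 ≤ r * C ^ 2 := by positivity
  nlinarith

theorem main_est (R a : ℝ) (hR : 0 < R) (ha : 0 < a) (S : StreamData R a)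
    (hG : ∀ r ∈ Set.Icc (0 : ℝ) R, S.Gam r a = 0 ∧ S.Gam r (-a) = 0) :
        I2 R a (fun r z =>
            (qdr (qdr (qdz S.psi)) r z) ^ 2 + (qdr (qdz (qdz S.psi)) r z) ^ 2 +
              (qdz (qdz (qdz S.psi)) r z) ^ 2) +
          (∫ z in Set.Ioo (-a) a, (qdz (qdz S.psi) 0 z) ^ 2) +
          (∫ z in Set.Ioo (-a) a, (qdr (qdz S.psi) R z) ^ 2) ≤
        2 * I2 R a (fun r z => (qdz S.Gam r z) ^ 2) := by
  have hψ : Sm S.psi := S.smooth_psi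
  have hΓ : Sm S.Gam := S.smooth_Gam
  have hrr : Sm (fun r _ : ℝ => r) := by unfold Sm; exact contDiff_fst
  set ψ := S.psi with hψd
  set Γ := S.Gam with hΓd
  -- equation multiplied by r
  have E0 : ∀ r ∈ Ioo (0 : ℝ) R, ∀ z ∈ Ioo (-a) a,
      r * qdr (qdr ψ) r z + 3 * qdr ψ r z + r * qdz (qdz ψ) r z + r * Γ r z = 0 := by
    intro r hr z hz
    have h := S.eqn r hr z hz
    have hr0 : r ≠ 0 := hr.1.ne'
    rw [← hψd, ← hΓd] at h
    rw [← h]; field_simp; ring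
  have E1 : ∀ r ∈ Ioo (0 : ℝ) R, ∀ z ∈ Ioo (-a) a,
      r * qdr (qdr (qdz ψ)) r z + 3 * qdr (qdz ψ) r z + r * qdz (qdz (qdz ψ)) r z
        + r * qdz Γ r z = 0 := by
    intro r hr z hz
    have h0 := deriv_zero_on hz (E0 r hr)
    have h1 := (((((hψ.qdr.qdr.dz r z).const_mul r).add ((hψ.qdr.dz r z).const_mul 3)).add
      ((hψ.qdz.qdz.dz r z).const_mul r)).add ((hΓ.dz r z).const_mul r)).deriv
    rw [hψ.qdr.comm, hψ.comm] at h1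
    rw [← h1]; exact h0
  -- boundary values
  have Ecl : ∀ r ∈ Ioo (0 : ℝ) R, ∀ z ∈ Icc (-a) a,
      r * qdr (qdr ψ) r z + 3 * qdr ψ r z + r * qdz (qdz ψ) r z + r * Γ r z = 0 := by
    intro r hr
    have hc : ∀ {w}, Sm w → Continuous (fun z => w r z) := fun hw =>
      hw.cont.comp (continuous_const.prodMk continuous_id)
    have c1 := hc hψ.qdr.qdr
    have c2 := hc hψ.qdr
    have c3 := hc hψ.qdz.qdz
    have c4 := hc hΓ
    have hcl : IsClosed {z | r * qdr (qdr ψ) r z + 3 * qdr ψ r z + r * qdz (qdz ψ) r z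
        + r * Γ r z = 0} := isClosed_eq (by fun_prop) continuous_const
    have := hcl.closure_subset_iff.2 (fun z hz => E0 r hr z hz)
    rw [closure_Ioo (by linarith)] at this
    exact this
  have horiz : ∀ b ∈ Icc (-a) a, (∀ r ∈ Icc (0 : ℝ) R, ψ r b = 0 ∧ Γ r b = 0) →
      ∀ r ∈ Ioo (0 : ℝ) R, qdz (qdz ψ) r b = 0 := by
    intro b hb h r hr
    have h1 : ∀ x ∈ Ioo (0 : ℝ) R, qdr ψ x b = 0 := fun x hx =>
      deriv_zero_on hx (fun y hy => (h y (Ioo_subset_Icc_self hy)).1)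
    have h2 : qdr (qdr ψ) r b = 0 := deriv_zero_on hr h1
    have h3 := Ecl r hr b hb
    rw [h1 r hr, h2, (h r (Ioo_subset_Icc_self hr)).2] at h3
    have : r * qdz (qdz ψ) r b = 0 := by linarith
    exact (mul_eq_zero.1 this).resolve_left hr.1.ne'
  have htop := horiz a ⟨by linarith, le_rfl⟩ (fun r hr => ⟨(S.bc_horiz r hr).1, (hG r hr).1⟩)
  have hbot := horiz (-a) ⟨le_rfl, by linarith⟩ (fun r hr => ⟨(S.bc_horiz r hr).2, (hG r hr).2⟩)
  have hlat : ∀ z ∈ Ioo (-a) a, qdz (qdz ψ) R z = 0 := fun z hz =>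
    deriv_zero_on hz (fun y hy => deriv_zero_on hy
      (fun x hx => S.bc_lat x (Ioo_subset_Icc_self hx)))
  have hax : ∀ z ∈ Ioo (-a) a, qdr (qdz ψ) 0 z = 0 := fun z hz => by
    rw [← hψ.comm]
    exact deriv_zero_on hz (fun x hx => S.axis x (Ioo_subset_Icc_self hx))
  have hu : Sm (qdz ψ) := hψ.qdz
  set u := qdz ψ with hud
  have sB := hu.qdr
  have sA := hu.qdr.qdr
  have sV := hu.qdz
  have sD := hu.qdz.qdr
  have sC := hu.qdz.qdz
  have sg := hΓ.qdz
  let T : ℝ → ℝ → ℝ := fun r z => 3 * (qdr u r z) ^ 2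
    - 4 * (r * (qdr (qdz u) r z * qdz u r z) + (qdz u r z) ^ 2)
  let P : ℝ → ℝ → ℝ := fun r z => 4 * (r * (qdr (qdr u) r z * qdz u r z)
    + 3 * (qdr u r z * qdz u r z))
  have hT : Sm T := by
    unfold Sm at *
    exact (contDiff_const.mul (sB.pow 2)).sub
      (contDiff_const.mul ((hrr.mul (sD.mul sV)).add (sV.pow 2)))
  have hP : Sm P := by
    unfold Sm at *
    exact contDiff_const.mul ((hrr.mul (sA.mul sV)).add (contDiff_const.mul (sB.mul sV)))
  have dT : ∀ r z, qdr T r z = 6 * qdr (qdr u) r z * qdr u r z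
      - 4 * (3 * qdr (qdz u) r z * qdz u r z + r * qdr (qdr (qdz u)) r z * qdz u r z
        + r * qdr (qdz u) r z ^ 2) := by
    intro r z
    have h := ((((sB.dr r z).pow 2).const_mul 3).sub
      ((((hasDerivAt_id r).mul ((sD.dr r z).mul (sV.dr r z))).add
        ((sV.dr r z).pow 2)).const_mul 4)).deriv
    refine Eq.trans h ?_
    simp
    ring
  have dP : ∀ r z, qdz P r z = 4 * (r * qdr (qdr (qdz u)) r z * qdz u r z
      + r * qdr (qdr u) r z * qdz (qdz u) r z + 3 * qdr (qdz u) r z * qdz u r z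
      + 3 * qdr u r z * qdz (qdz u) r z) := by
    intro r z
    have h := (((((sA.dz r z).mul (sV.dz r z)).const_mul r).add
        (((sB.dz r z).mul (sV.dz r z)).const_mul 3)).const_mul 4).deriv
    refine Eq.trans h ?_
    rw [sB.comm, hu.comm]
    ring
  have div := diverg hR ha hT hP
  have z1 : ∫ x in Ioo 0 R, P x a = 0 := by
    rw [setIntegral_congr_fun measurableSet_Ioo (g := fun _ => (0 : ℝ))]
    · simp
    · intro x hx; simp [P, htop x hx]
  have z2 : ∫ x in Ioo 0 R, P x (-a) = 0 := by
    rw [setIntegral_congr_fun measurableSet_Ioo (g := fun _ => (0 : ℝ))]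
    · simp
    · intro x hx; simp [P, hbot x hx]
  have z3 : ∫ z in Ioo (-a) a, T R z = 3 * ∫ z in Ioo (-a) a, (qdr u R z) ^ 2 := by
    rw [← integral_const_mul]
    refine setIntegral_congr_fun measurableSet_Ioo ?_
    intro z hz; simp [T, hlat z hz]
  have z4 : ∫ z in Ioo (-a) a, T 0 z = (-4) * ∫ z in Ioo (-a) a, (qdz u 0 z) ^ 2 := by
    rw [← integral_const_mul]
    refine setIntegral_congr_fun measurableSet_Ioo ?_
    intro z hz; simp [T, hax z hz]
  have n1 : 0 ≤ ∫ z in Ioo (-a) a, (qdr u R z) ^ 2 := integral_nonneg fun z => sq_nonneg _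
  have n2 : 0 ≤ ∫ z in Ioo (-a) a, (qdz u 0 z) ^ 2 := integral_nonneg fun z => sq_nonneg _
  rw [z1, z2, z3, z4] at div
  have cA := sA.cont
  have cD := sD.cont
  have cC := sC.cont
  have cg := sg.cont
  have cT := hT.qdr.cont
  have cP := hP.qdz.cont
  have i1 : IntegrableOn (fun q : ℝ × ℝ => ((qdr (qdr u) q.1 q.2) ^ 2 + (qdr (qdz u) q.1 q.2) ^ 2 +
      (qdz (qdz u) q.1 q.2) ^ 2) * q.1) ((Ioo (0 : ℝ) R) ×ˢ (Ioo (-a) a)) :=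
    integ R a (by fun_prop)
  have i2 : IntegrableOn (fun q : ℝ × ℝ => qdr T q.1 q.2 + qdz P q.1 q.2)
      ((Ioo (0 : ℝ) R) ×ˢ (Ioo (-a) a)) :=
    integ R a (by fun_prop)
  have i3 : IntegrableOn (fun q : ℝ × ℝ => 2 * (qdz Γ q.1 q.2 ^ 2 * q.1))
      ((Ioo (0 : ℝ) R) ×ˢ (Ioo (-a) a)) :=
    integ R a (by fun_prop)
  have mono := setIntegral_mono_on (i1.add i2) i3 (measurableSet_Ioo.prod measurableSet_Ioo) (by
    rintro ⟨r, z⟩ ⟨hr, hz⟩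
    have := ptwise (D := qdr (qdz u) r z) hr.1 (E1 r hr z hz)
    simp only [Pi.add_apply, dT, dP]
    linarith)
  simp only [Pi.add_apply] at mono
  rw [integral_add i1 i2, div, integral_const_mul] at mono
  unfold I2
  linarith

/-- second `H³` elliptic estimate for `ψ₁`: if moreover
`Γ(·,±a) = 0`, then
`∫_Ω ((∂_r²∂_zψ₁)² + (∂_r∂_z²ψ₁)² + (∂_z³ψ₁)²) + ∫_{−a}^{a} (∂_z²ψ₁(0,z))² dz
  + ∫_{−a}^{a} (∂_r∂_zψ₁(R,z))² dz ≤ c |∂_zΓ|²_{2,Ω}` for an absolute constant `c`. -/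
theorem statement11 :
    ∃ c : ℝ,
      ∀ (R a : ℝ), 0 < R → 0 < a → ∀ S : StreamData R a,
        (∀ r ∈ Set.Icc (0 : ℝ) R, S.Gam r a = 0 ∧ S.Gam r (-a) = 0) →
        I2 R a (fun r z =>
            (qdr (qdr (qdz S.psi)) r z) ^ 2 + (qdr (qdz (qdz S.psi)) r z) ^ 2 +
              (qdz (qdz (qdz S.psi)) r z) ^ 2) +
          (∫ z in Set.Ioo (-a) a, (qdz (qdz S.psi) 0 z) ^ 2) +
          (∫ z in Set.Ioo (-a) a, (qdr (qdz S.psi) R z) ^ 2) ≤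
        c * I2 R a (fun r z => (qdz S.Gam r z) ^ 2) := by
  exact ⟨2, fun R a hR ha S hG => main_est R a hR ha S hG⟩
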